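/- Let X be a geodesic δ-hyperbolic metric space and let Y be a uniformly locally finite subset of X. Then for each ε > 0 and D > 0 there exists a constant N = N(ε,D,Y) such that for every finite set A ⊆ Y there exists a subset A' ⊆ A satisfying: (1) #A' ≥ (1−ε)·#A; and (2) for each a ∈ A' there exist points y₁, y₂ ∈ X such that #(A \ (𝓗_D(a,y₁) ∪ 𝓗_D(a,y₂))) ≤ N. -/

import Mathlib

noncomputable section

open Set Metric Pointwise

/-- The Gromov product `(y|z)_x`. -/
def gromovProd {X : Type*} [MetricSpace X] (x y z : X) : ℝ :=
  (dist x y + dist x z - dist y z) / 2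

/-- `γ` restricted to `[a, b]` is a unit-speed geodesic. -/
def IsGeodesicParam {X : Type*} [MetricSpace X] (γ : ℝ → X) (a b : ℝ) : Prop :=
  ∀ s ∈ Set.Icc a b, ∀ t ∈ Set.Icc a b, dist (γ s) (γ t) = |s - t|

/-- `γ` is a geodesic from `x` to `y`, parametrized by arclength on `[0, dist x y]`. -/
def IsGeodesicBetween {X : Type*} [MetricSpace X] (γ : ℝ → X) (x y : X) : Prop :=
  γ 0 = x ∧ γ (dist x y) = y ∧ IsGeodesicParam γ 0 (dist x y)

/-- A geodesic metric space: any two points are joined by a geodesic. -/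
def GeodesicSpace (X : Type*) [MetricSpace X] : Prop :=
  ∀ x y : X, ∃ γ : ℝ → X, IsGeodesicBetween γ x y

/-- A geodesic space in which every geodesic triangle is `δ`-thin. -/
def GromovHyperbolic (X : Type*) [MetricSpace X] (δ : ℝ) : Prop :=
  GeodesicSpace X ∧
    ∀ (x y z : X) (γ₁ γ₂ γ₃ : ℝ → X),
      IsGeodesicBetween γ₁ x z → IsGeodesicBetween γ₂ x y → IsGeodesicBetween γ₃ y z →
        ∀ t ∈ Set.Icc (0 : ℝ) (dist x z),
          ∃ u ∈ γ₂ '' Set.Icc (0 : ℝ) (dist x y) ∪ γ₃ '' Set.Icc (0 : ℝ) (dist y z),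
            dist (γ₁ t) u ≤ δ

/-- A subset of `X` which is the image of a geodesic segment. -/
def IsGeodesicSegSet {X : Type*} [MetricSpace X] (A : Set X) : Prop :=
  ∃ (γ : ℝ → X) (a b : ℝ), a ≤ b ∧ IsGeodesicParam γ a b ∧ A = γ '' Set.Icc a b

/-- The set of nearest-point projections of `x` to `A`. -/
def nearestPts {X : Type*} [MetricSpace X] (A : Set X) (x : X) : Set X :=
  {a ∈ A | dist x a = Metric.infDist x A}

/-- The nearest-point projection of the set `B` to `A`. -/
def projSet {X : Type*} [MetricSpace X] (A B : Set X) : Set X := ⋃ x ∈ B, nearestPts A x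

/-- `diam_A(B)`, the diameter of the projection of `B` to `A`. -/
def projDiam {X : Type*} [MetricSpace X] (A B : Set X) : ℝ := Metric.diam (projSet A B)

/-- `d_A(B, C) = diam (π_A (B ∪ C))`. -/
def projDist {X : Type*} [MetricSpace X] (A B C : Set X) : ℝ := Metric.diam (projSet A (B ∪ C))

/-- The halfspace `H_half(x, y)` of points at least as close to `x` as to `y`. -/
def halfspace {X : Type*} [MetricSpace X] (x y : X) : Set X := {z | dist z x ≤ dist z y}

/-- A group is virtually cyclic if it has a cyclic subgroup of finite index. -/
def VirtuallyCyclic (G : Type*) [Group G] : Prop :=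
  ∃ H : Subgroup G, H.FiniteIndex ∧ IsCyclic H

/-- The WPD property for `f` relative to the basepoint `x₀`. -/
def WPD {G : Type*} [Group G] {X : Type*} [MetricSpace X] [MulAction G X]
    (f : G) (x₀ : X) : Prop :=
  ∀ R : ℝ, 0 < R → ∃ L : ℕ, 0 < L ∧
    {g : G | dist x₀ (g • x₀) < R ∧ dist ((f ^ L) • x₀) ((g * f ^ L) • x₀) < R}.Finite

/-- The word norm with respect to the generating set `S`. -/
def wordNorm {G : Type*} [Group G] (S : Finset G) (g : G) : ℕ :=
  sInf {n : ℕ | ∃ l : List G, l.length = n ∧ (∀ x ∈ l, x ∈ S ∨ x⁻¹ ∈ S) ∧ l.prod = g}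

/-- The word metric with respect to the generating set `S`. -/
def wordDist {G : Type*} [Group G] (S : Finset G) (g h : G) : ℕ := wordNorm S (g⁻¹ * h)

/-- `B` is an `r`-roughly branching subset of `G`. -/
def RoughlyBranching {G : Type*} [Group G] (S : Finset G) (r : ℝ) (B : Set G) : Prop :=
  ∃ B' : Set G,
    (∀ b ∈ B, ∃ b' ∈ B', (wordDist S b b' : ℝ) ≤ r) ∧
    ∀ k : ℕ, 1 ≤ k → ∀ g h : Fin k → G, (∀ i, g i ∈ B') → (∀ i, h i ∈ B') →
      (List.ofFn g).prod = (List.ofFn h).prod → g = h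

theorem gromovProd_le_dist_of_dist_add_dist_eq {X : Type*} [MetricSpace X] {w x y u : X}
    (h : dist x u + dist u y = dist x y) : gromovProd w x y ≤ dist w u := by
  have h₁ := dist_triangle w u x
  have h₂ := dist_triangle w u y
  rw [dist_comm u x] at h₁
  unfold gromovProd
  linarith

theorem IsGeodesicBetween.dist_add_dist {X : Type*} [MetricSpace X] {γ : ℝ → X} {x y : X}
    (h : IsGeodesicBetween γ x y) {t : ℝ} (ht : t ∈ Set.Icc (0 : ℝ) (dist x y)) :
    dist x (γ t) + dist (γ t) y = dist x y := by
  obtain ⟨h0, h1, hp⟩ := h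
  have e₁ := hp 0 ⟨le_rfl, dist_nonneg⟩ t ht
  have e₂ := hp t ht (dist x y) ⟨dist_nonneg, le_rfl⟩
  rw [h0, zero_sub, abs_neg, abs_of_nonneg ht.1] at e₁
  rw [h1, abs_sub_comm, abs_of_nonneg (sub_nonneg.2 ht.2)] at e₂
  linarith

theorem IsGeodesicParam.continuousOn {X : Type*} [MetricSpace X] {γ : ℝ → X} {a b : ℝ}
    (h : IsGeodesicParam γ a b) : ContinuousOn γ (Set.Icc a b) := by
  have : LipschitzOnWith 1 γ (Set.Icc a b) :=
    LipschitzOnWith.of_dist_le_mul fun s hs t ht => by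
      rw [h s hs t ht, NNReal.coe_one, one_mul, Real.dist_eq]
  exact this.continuousOn

/-- A geodesic `[y, z]` passes within `(y|z)_x + 2δ` of `x`. -/
theorem GromovHyperbolic.exists_dist_le_gromovProd {X : Type*} [MetricSpace X] {δ : ℝ}
    (hX : GromovHyperbolic X δ) (x : X) {y z : X} {γ : ℝ → X} (hγ : IsGeodesicBetween γ y z) :
    ∃ t ∈ Set.Icc (0 : ℝ) (dist y z), dist x (γ t) ≤ gromovProd x y z + 2 * δ := by
  obtain ⟨γ₂, h₂⟩ := hX.1 y x
  obtain ⟨γ₃, h₃⟩ := hX.1 x z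
  have hthin := hX.2 y x z γ γ₂ γ₃ hγ h₂ h₃
  have hmem0 : (0 : ℝ) ∈ Set.Icc (0 : ℝ) (dist y z) := ⟨le_rfl, dist_nonneg⟩
  have hmem1 : dist y z ∈ Set.Icc (0 : ℝ) (dist y z) := ⟨dist_nonneg, le_rfl⟩
  have hδ : 0 ≤ δ := by
    obtain ⟨u, -, hu⟩ := hthin 0 hmem0
    exact dist_nonneg.trans hu
  have hc := hγ.2.2.continuousOn
  have near : ∀ v : X, IsClosed {t : Set.Icc (0 : ℝ) (dist y z) |
      dist x (γ t) + dist (γ t) v ≤ dist x v + 2 * δ} := by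
    intro v
    have hc' : Continuous fun t : Set.Icc (0 : ℝ) (dist y z) => γ t :=
      continuousOn_iff_continuous_domRestrict.1 hc
    exact isClosed_le ((continuous_const.dist hc').add (hc'.dist continuous_const))
      continuous_const
  have : PreconnectedSpace (Set.Icc (0 : ℝ) (dist y z)) :=
    Subtype.preconnectedSpace isPreconnected_Icc
  obtain ⟨t, -, ht₁, ht₂⟩ := isPreconnected_closed_iff.1
    (isPreconnected_univ (α := Set.Icc (0 : ℝ) (dist y z))) _ _ (near y) (near z)
    (by
      intro t _
      obtain ⟨u, hu, htu⟩ := hthin t t.2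
      have a₁ := dist_triangle x u (γ t)
      rw [dist_comm u] at a₁
      rcases hu with ⟨s, hs, rfl⟩ | ⟨s, hs, rfl⟩
      · left
        have a₂ := dist_triangle (γ t) (γ₂ s) y
        have a₃ := h₂.dist_add_dist hs
        rw [dist_comm y, dist_comm _ x, dist_comm y] at a₃
        simp only [Set.mem_ofPred_eq]
        linarith
      · right
        have a₂ := dist_triangle (γ t) (γ₃ s) z
        have a₃ := h₃.dist_add_dist hs
        simp only [Set.mem_ofPred_eq]
        linarith)
    ⟨⟨0, hmem0⟩, trivial, by simp [hγ.1, hδ]⟩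
    ⟨⟨dist y z, hmem1⟩, trivial, by simp [hγ.2.1, hδ]⟩
  refine ⟨t, t.2, ?_⟩
  have hsum := hγ.dist_add_dist t.2
  simp only [Set.mem_ofPred_eq] at ht₁ ht₂
  rw [dist_comm _ y] at ht₁
  unfold gromovProd
  linarith

/-- The four-point inequality for Gromov products in a space with thin triangles. -/
theorem GromovHyperbolic.min_gromovProd_le {X : Type*} [MetricSpace X] {δ : ℝ}
    (hX : GromovHyperbolic X δ) (w x y z : X) :
    min (gromovProd w x y) (gromovProd w y z) ≤ gromovProd w x z + 3 * δ := by
  obtain ⟨γ₁, h₁⟩ := hX.1 x z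
  obtain ⟨γ₂, h₂⟩ := hX.1 x y
  obtain ⟨γ₃, h₃⟩ := hX.1 y z
  obtain ⟨t, ht, hwt⟩ := hX.exists_dist_le_gromovProd w h₁
  obtain ⟨u, hu, htu⟩ := hX.2 x y z γ₁ γ₂ γ₃ h₁ h₂ h₃ t ht
  have hwu : dist w u ≤ gromovProd w x z + 3 * δ := by
    have := dist_triangle w (γ₁ t) u
    linarith
  rcases hu with ⟨s, hs, rfl⟩ | ⟨s, hs, rfl⟩
  · exact (min_le_left _ _).trans
      ((gromovProd_le_dist_of_dist_add_dist_eq (h₂.dist_add_dist hs)).trans hwu)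
  · exact (min_le_right _ _).trans
      ((gromovProd_le_dist_of_dist_add_dist_eq (h₃.dist_add_dist hs)).trans hwu)

theorem gromovProd_comm {X : Type*} [MetricSpace X] (x y z : X) :
    gromovProd x y z = gromovProd x z y := by
  unfold gromovProd
  rw [dist_comm y z]
  ring

theorem gromovProd_add_gromovProd {X : Type*} [MetricSpace X] (a h z : X) :
    gromovProd a z h + gromovProd h z a = dist a h := by
  unfold gromovProd
  rw [dist_comm h a, dist_comm h z, dist_comm z a]
  ring

theorem half_dist_le_gromovProd {X : Type*} [MetricSpace X] {o a h : X}
    (hle : dist o a ≤ dist o h) : dist a h / 2 ≤ gromovProd h a o := by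
  unfold gromovProd
  rw [dist_comm h a, dist_comm h o, dist_comm a o]
  linarith

/-- If `h` is at least as far from `o` as `a`, and `h` lies roughly between `z` and `o`, then
`z` and `h` lie in the same direction from `a`. -/
theorem lt_gromovProd_of_dist_le {X : Type*} [MetricSpace X] {η D : ℝ}
    (hη : ∀ w x y z : X, min (gromovProd w x y) (gromovProd w y z) ≤ gromovProd w x z + η)
    {o a h z : X} (hsep : 2 * (D + 3 * η) ≤ dist a h) (hle : dist o a ≤ dist o h)
    (hz : gromovProd h z o < D + 2 * η) : D + 3 * η < gromovProd a z h := by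
  have h₁ := hη h z a o
  have h₂ := half_dist_le_gromovProd hle
  have h₃ := gromovProd_add_gromovProd a h z
  rcases min_le_iff.1 h₁ with h₁ | h₁ <;> linarith

/-- Every finite set contains an `S`-separated subset that is `S`-dense in it. -/
theorem exists_separated_subset {X : Type*} [MetricSpace X] (S : ℝ) (B : Finset X) :
    ∃ B' ⊆ B, (∀ x ∈ B', ∀ y ∈ B', x ≠ y → S ≤ dist x y) ∧
      ∀ b ∈ B, ∃ b' ∈ B', b = b' ∨ dist b b' ≤ S := by
  classical
  induction B using Finset.induction_on with
  | empty => exact ⟨∅, by simp⟩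
  | insert b B hb ih =>
    obtain ⟨B', hB', hsep, hden⟩ := ih
    by_cases hclose : ∃ b' ∈ B', dist b b' ≤ S
    · refine ⟨B', hB'.trans (Finset.subset_insert _ _), hsep, fun x hx => ?_⟩
      rcases Finset.mem_insert.1 hx with rfl | hx
      · obtain ⟨b', h, h'⟩ := hclose
        exact ⟨b', h, Or.inr h'⟩
      · exact hden x hx
    · push Not at hclose
      refine ⟨insert b B', Finset.insert_subset_insert _ hB', fun x hx y hy hxy => ?_,
        fun x hx => ?_⟩
      · rcases Finset.mem_insert.1 hx with rfl | hxB <;>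
          rcases Finset.mem_insert.1 hy with rfl | hyB
        · exact absurd rfl hxy
        · exact (hclose y hyB).le
        · rw [dist_comm]
          exact (hclose x hxB).le
        · exact hsep x hxB y hyB hxy
      · rcases Finset.mem_insert.1 hx with rfl | hx
        · exact ⟨x, Finset.mem_insert_self _ _, Or.inl rfl⟩
        · obtain ⟨b', h, h'⟩ := hden x hx
          exact ⟨b', Finset.mem_insert_of_mem h, h'⟩

/-- The points of `B` are processed in order of decreasing distance to `o`. The set `U` collects
the points of `A` not yet cut off, and the points of `W` stand for the points cut off so far, each
counted with weight `K`. Processing a point lowers the total weight by at least `K`. -/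
theorem card_mul_le_of_separated_of_lt_ncard {X : Type*} [MetricSpace X] {η D : ℝ} (hη0 : 0 ≤ η)
    (hη : ∀ w x y z : X, min (gromovProd w x y) (gromovProd w y z) ≤ gromovProd w x z + η)
    (o : X) (A B : Finset X) (K : ℕ)
    (hsep : ∀ x ∈ B, ∀ y ∈ B, x ≠ y → 2 * (D + 3 * η) ≤ dist x y)
    (hbad : ∀ a ∈ B, ∀ y₁ y₂ : X, 2 * K < ((A : Set X) \
      ({z : X | D ≤ gromovProd a z y₁} ∪ {z : X | D ≤ gromovProd a z y₂})).ncard) :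
    ∃ U W : Finset X, W ⊆ B ∧ (∀ z ∈ A, z ∈ U ∨ ∃ h ∈ W, gromovProd h z o < D + 2 * η) ∧
      U.card + K * W.card + K * B.card ≤ A.card := by
  classical
  induction B using Finset.induction_on_max_value (fun x => - dist o x) with
  | empty => exact ⟨A, ∅, by simp, fun z hz => Or.inl hz, by simp⟩
  | insert a s has hmax ih =>
    obtain ⟨U, W, hWs, hcov, hcard⟩ := ih
      (fun x hx y hy => hsep x (Finset.mem_insert_of_mem hx) y (Finset.mem_insert_of_mem hy))
      (fun x hx => hbad x (Finset.mem_insert_of_mem hx))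
    have hgeo : ∀ h ∈ W, ∀ z, gromovProd h z o < D + 2 * η → D + 3 * η < gromovProd a z h := by
      intro h hh z hz
      have hs := hWs hh
      refine lt_gromovProd_of_dist_le hη (hsep a (Finset.mem_insert_self _ _) h
        (Finset.mem_insert_of_mem hs) ?_) (neg_le_neg_iff.1 (hmax h hs)) hz
      rintro rfl
      exact has hs
    have haW : a ∉ W := fun h => has (hWs h)
    set U₁ := U.filter fun z => D + η ≤ gromovProd a z o
    set U₂ := U.filter fun z => ¬ D + η ≤ gromovProd a z o
    set W₁ := W.filter fun z => D + η ≤ gromovProd a z o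
    set W₂ := W.filter fun z => ¬ D + η ≤ gromovProd a z o
    have hU : U₁.card + U₂.card = U.card := Finset.card_filter_add_card_filter_not _
    have hW : W₁.card + W₂.card = W.card := Finset.card_filter_add_card_filter_not _
    have hlight : ∀ y : X, (∀ h ∈ W₂, h = y) → 2 * K < U₂.card := by
      intro y hy
      refine (hbad a (Finset.mem_insert_self _ _) o y).trans_le ?_
      rw [← Set.ncard_coe_finset]
      refine Set.ncard_le_ncard ?_ (Finset.finite_toSet _)
      rintro z ⟨hzA, hz⟩
      simp only [Set.mem_union, Set.mem_ofPred_eq, not_or, not_le] at hz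
      rcases hcov z hzA with hzU | ⟨h, hh, hzh⟩
      · exact Finset.mem_coe.2 (Finset.mem_filter.2 ⟨hzU, by linarith [hz.1]⟩)
      · exfalso
        have hg := hgeo h hh z hzh
        by_cases hho : D + η ≤ gromovProd a h o
        · rcases min_le_iff.1 (hη a z h o) with h₁ | h₁ <;> linarith [hz.1]
        · have := hy h (Finset.mem_filter.2 ⟨hh, hho⟩)
          subst this
          linarith [hz.2]
    have hweight : 2 * K ≤ U₂.card + K * W₂.card := by
      rcases le_or_gt W₂.card 1 with h1 | h2
      · have : ∃ y : X, ∀ h ∈ W₂, h = y := by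
          rcases W₂.eq_empty_or_nonempty with h0 | ⟨y, hy⟩
          · exact ⟨o, by simp [h0]⟩
          · exact ⟨y, fun h hh => Finset.card_le_one.1 h1 h hh y hy⟩
        obtain ⟨y, hy⟩ := this
        have := hlight y hy
        omega
      · have : K * 2 ≤ K * W₂.card := Nat.mul_le_mul_left K h2
        omega
    refine ⟨U₁, insert a W₁, ?_, ?_, ?_⟩
    · exact Finset.insert_subset_insert _ ((Finset.filter_subset _ _).trans hWs)
    · intro z hzA
      rcases hcov z hzA with hzU | ⟨h, hh, hzh⟩
      · by_cases hzo : D + η ≤ gromovProd a z o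
        · exact Or.inl (Finset.mem_filter.2 ⟨hzU, hzo⟩)
        · exact Or.inr ⟨a, Finset.mem_insert_self _ _, by linarith⟩
      · by_cases hho : D + η ≤ gromovProd a h o
        · exact Or.inr ⟨h, Finset.mem_insert_of_mem (Finset.mem_filter.2 ⟨hh, hho⟩), hzh⟩
        · refine Or.inr ⟨a, Finset.mem_insert_self _ _, ?_⟩
          have hg := hgeo h hh z hzh
          rw [gromovProd_comm] at hg
          rcases min_le_iff.1 (hη a h z o) with h₁ | h₁ <;> linarith
    · rw [Finset.card_insert_of_notMem has,
        Finset.card_insert_of_notMem fun h => haW (Finset.mem_filter.1 h).1]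
      rw [← hU, ← hW] at hcard
      linarith

/-- **Hyperbolic magic lemma** for uniformly locally finite subsets of a Gromov
hyperbolic space. Here `𝓗_D(a, y) = {z : (z|y)_a ≥ D}`. -/
theorem hyperbolic_magic_lemma
    {X : Type*} [MetricSpace X] (δ : ℝ) (hX : GromovHyperbolic X δ)
    (Y : Set X)
    (hY : ∀ R : ℝ, 0 < R → ∃ M : ℕ, ∀ y ∈ Y,
      (Y ∩ Metric.closedBall y R).Finite ∧ (Y ∩ Metric.closedBall y R).ncard ≤ M)
    (ε D : ℝ) (hε : 0 < ε) (hD : 0 < D) :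
    ∃ N : ℕ, ∀ A : Finset X, (A : Set X) ⊆ Y →
      ∃ A' : Finset X, A' ⊆ A ∧ (1 - ε) * (A.card : ℝ) ≤ (A'.card : ℝ) ∧
        ∀ a ∈ A', ∃ y₁ y₂ : X,
          ((A : Set X) \
            ({z : X | D ≤ gromovProd a z y₁} ∪ {z : X | D ≤ gromovProd a z y₂})).ncard ≤ N := by
  classical
  set η : ℝ := 3 * |δ|
  have hη0 : 0 ≤ η := by positivity
  have hη : ∀ w x y z : X, min (gromovProd w x y) (gromovProd w y z) ≤ gromovProd w x z + η :=
    fun w x y z => (hX.min_gromovProd_le w x y z).trans (by linarith [le_abs_self δ])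
  obtain ⟨M, hM⟩ := hY (2 * (D + 3 * η)) (by positivity)
  obtain ⟨K, hK⟩ := exists_nat_gt ((M : ℝ) / ε)
  have hK0 : (0 : ℝ) < K := lt_of_le_of_lt (by positivity) hK
  refine ⟨2 * K, fun A hA => ?_⟩
  set B : Finset X := A.filter fun a => ∀ y₁ y₂ : X, 2 * K < ((A : Set X) \
      ({z : X | D ≤ gromovProd a z y₁} ∪ {z : X | D ≤ gromovProd a z y₂})).ncard
  have hBA : B ⊆ A := Finset.filter_subset _ _
  refine ⟨A \ B, Finset.sdiff_subset, ?_, fun a ha => ?_⟩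
  · have hBcard : (B.card : ℝ) ≤ ε * A.card := by
      rcases B.eq_empty_or_nonempty with h0 | ⟨o, -⟩
      · rw [h0, Finset.card_empty, Nat.cast_zero]
        positivity
      obtain ⟨B', hB'B, hsep, hden⟩ := exists_separated_subset (2 * (D + 3 * η)) B
      obtain ⟨U, W, -, -, hcard⟩ := card_mul_le_of_separated_of_lt_ncard hη0 hη o A B' K hsep
        fun a ha => (Finset.mem_filter.1 (hB'B ha)).2
      have hcount : B.card ≤ B'.card * M := by
        have hcover : B ⊆ B'.biUnion fun b' => B.filter fun b => dist b b' ≤ 2 * (D + 3 * η) := by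
          intro b hb
          obtain ⟨b', hb', h⟩ := hden b hb
          refine Finset.mem_biUnion.2 ⟨b', hb', Finset.mem_filter.2 ⟨hb, ?_⟩⟩
          rcases h with rfl | h
          · rw [dist_self]
            positivity
          · exact h
        refine (Finset.card_le_card hcover).trans (Finset.card_biUnion_le_card_mul _ _ _ ?_)
        intro b' hb'
        obtain ⟨hfin, hle⟩ := hM b' (hA (hBA (hB'B hb')))
        rw [← Set.ncard_coe_finset]
        refine (Set.ncard_le_ncard ?_ hfin).trans hle
        intro b hb
        obtain ⟨hb, hd⟩ := Finset.mem_filter.1 (Finset.mem_coe.1 hb)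
        exact ⟨hA (hBA hb), hd⟩
      have h₁ : (K : ℝ) * B'.card ≤ A.card := by
        exact_mod_cast (Nat.le_add_left _ _).trans hcard
      have h₂ : (B.card : ℝ) ≤ B'.card * M := by exact_mod_cast hcount
      have h₃ : (M : ℝ) ≤ K * ε := ((div_lt_iff₀ hε).1 hK).le
      calc (B.card : ℝ) ≤ B'.card * M := h₂
        _ ≤ B'.card * (K * ε) := by gcongr
        _ = ε * (K * B'.card) := by ring
        _ ≤ ε * A.card := by gcongr
    rw [Finset.cast_card_sdiff hBA]
    linarith
  · obtain ⟨haA, haB⟩ := Finset.mem_sdiff.1 ha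
    by_contra hcon
    push Not at hcon
    exact haB (Finset.mem_filter.2 ⟨haA, hcon⟩)
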